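/- arXiv:2502.12523 — 2 statements merged into one kernel-verified Lean document; each statement's English description precedes it below -/
import Mathlib

section
/- Let G=(V,E) be a hypergraph and let k ≥ 1 and g ≥ 1 be integers. The (k,g)-core of G equals the union, over all integers k' ≥ k and g' ≥ g, of the leaf sets L(k',g'), where L(k',g') is the set of nodes belonging to the (k',g')-core but neither to the (k'+1,g')-core nor to the (k',g'+1)-core. (This is the correctness of vertical locality-based query processing: aggregating all leaf nodes reachable from the (k,g)-leaf via next links and jump links recovers the (k,g)-core.) -/
/-- A set `H ⊆ V` is `(k,g)`-valid in the hypergraph `(V, E)` if every node `v ∈ H`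
has at least `k` distinct nodes `w ∈ H`, `w ≠ v`, such that at least `g` hyperedges
of `E` contain both `v` and `w`. -/
def kgValid {α : Type*} [DecidableEq α] (V : Finset α) (E : Finset (Finset α))
    (k g : ℕ) (H : Finset α) : Prop :=
  H ⊆ V ∧ ∀ v ∈ H,
    k ≤ (H.filter fun w => w ≠ v ∧ g ≤ (E.filter fun e => v ∈ e ∧ w ∈ e).card).card

/- The `(k,g)`-core of the hypergraph `(V, E)`: the union of all `(k,g)`-valid
subsets of `V`. -/
open Classical in
noncomputable def kgCore {α : Type*} [DecidableEq α] (V : Finset α)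
    (E : Finset (Finset α)) (k g : ℕ) : Finset α :=
  (V.powerset.filter fun H => kgValid V E k g H).sup id

/-- The leaf set `L(k,g)`: nodes in the `(k,g)`-core but in neither the
`(k+1,g)`-core nor the `(k,g+1)`-core. -/
noncomputable def kgLeaf {α : Type*} [DecidableEq α] (V : Finset α)
    (E : Finset (Finset α)) (k g : ℕ) : Finset α :=
  kgCore V E k g \ (kgCore V E (k + 1) g ∪ kgCore V E k (g + 1))

theorem mem_kgCore {α : Type*} [DecidableEq α] {V : Finset α} {E : Finset (Finset α)}
    {k g : ℕ} {v : α} : v ∈ kgCore V E k g ↔ ∃ H, kgValid V E k g H ∧ v ∈ H := by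
  simp only [kgCore, Finset.mem_sup, Finset.mem_filter, Finset.mem_powerset, id]
  exact ⟨fun ⟨H, h, hv⟩ => ⟨H, h.2, hv⟩, fun ⟨H, h, hv⟩ => ⟨H, ⟨h.1, h⟩, hv⟩⟩

theorem kgValid.mono {α : Type*} [DecidableEq α] {V : Finset α} {E : Finset (Finset α)}
    {k k' g g' : ℕ} {H : Finset α} (hk : k ≤ k') (hg : g ≤ g') (h : kgValid V E k' g' H) :
    kgValid V E k g H :=
  ⟨h.1, fun v hv => hk.trans <| (h.2 v hv).trans <| Finset.card_le_card <|
    Finset.monotone_filter_right _ fun _ _ hw => ⟨hw.1, hg.trans hw.2⟩⟩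

theorem kgCore_antitone {α : Type*} [DecidableEq α] {V : Finset α} {E : Finset (Finset α)}
    {k k' g g' : ℕ} (hk : k ≤ k') (hg : g ≤ g') : kgCore V E k' g' ⊆ kgCore V E k g := by
  intro v hv
  obtain ⟨H, hH, hvH⟩ := mem_kgCore.1 hv
  exact mem_kgCore.2 ⟨H, hH.mono hk hg, hvH⟩

theorem le_card_of_mem_kgCore {α : Type*} [DecidableEq α] {V : Finset α}
    {E : Finset (Finset α)} {k g : ℕ} {v : α} (hk : 1 ≤ k) (hv : v ∈ kgCore V E k g) :
    k ≤ V.card ∧ g ≤ E.card := by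
  obtain ⟨H, hH, hvH⟩ := mem_kgCore.1 hv
  have hcard := hH.2 v hvH
  refine ⟨hcard.trans ((Finset.card_filter_le _ _).trans (Finset.card_le_card hH.1)), ?_⟩
  obtain ⟨w, hw⟩ := Finset.card_pos.1 (hk.trans hcard)
  exact (Finset.mem_filter.1 hw).2.2.trans (Finset.card_filter_le _ _)

theorem exists_mem_kgLeaf_of_mem_kgCore {α : Type*} [DecidableEq α] {V : Finset α}
    {E : Finset (Finset α)} {k g : ℕ} {v : α} (hk : 1 ≤ k) (hv : v ∈ kgCore V E k g) :
    ∃ k', k ≤ k' ∧ ∃ g', g ≤ g' ∧ v ∈ kgLeaf V E k' g' := by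
  have hle := le_card_of_mem_kgCore hk hv
  by_cases h₁ : v ∈ kgCore V E (k + 1) g
  · obtain ⟨k', hk', g', hg', h⟩ := exists_mem_kgLeaf_of_mem_kgCore (by omega) h₁
    exact ⟨k', by omega, g', hg', h⟩
  by_cases h₂ : v ∈ kgCore V E k (g + 1)
  · obtain ⟨k', hk', g', hg', h⟩ := exists_mem_kgLeaf_of_mem_kgCore hk h₂
    exact ⟨k', hk', g', by omega, h⟩
  exact ⟨k, le_rfl, g, le_rfl, by simp [kgLeaf, hv, h₁, h₂]⟩
termination_by V.card + E.card + 1 - (k + g)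
decreasing_by all_goals omega

/-- Correctness of vertical locality-based query processing: the `(k,g)`-core is the
union of the leaf sets `L(k',g')` over all `k' ≥ k` and `g' ≥ g`. -/
theorem kgCore_eq_iUnion_leaves {α : Type*} [DecidableEq α] (V : Finset α)
    (E : Finset (Finset α)) (k g : ℕ) (hk : 1 ≤ k) (hg : 1 ≤ g) :
    (kgCore V E k g : Set α) =
      ⋃ (k' : ℕ) (_ : k ≤ k') (g' : ℕ) (_ : g ≤ g'), (kgLeaf V E k' g' : Set α) := by
  ext v
  simp only [Set.mem_iUnion, Finset.mem_coe, exists_prop]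
  refine ⟨exists_mem_kgLeaf_of_mem_kgCore hk, ?_⟩
  rintro ⟨k', hk', g', hg', h⟩
  exact kgCore_antitone hk' hg' (Finset.mem_sdiff.1 h).1
end

section
/- Let G=(V,E) be a hypergraph, let k and g be integers, and let d', d'' be integers with 1 ≤ d' < d'', k - d'' ≥ 1, and g - d'' ≥ 1. For an integer d ≥ 1, let D(d) denote the intersection of the leaf sets L(k-d+i, g-i) for i = 0, 1, ..., d (the depth-d entries of the (k,g)-auxiliary node). Then D(d') and D(d'') are disjoint: no node lies at two different depths of the same auxiliary node. (Theorem 1 of the paper.) -/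
/-- The depth-`d` entries of the `(k,g)`-auxiliary node: the intersection of the
leaf sets `L(k-d+i, g-i)` for `i = 0, 1, ..., d`. -/
noncomputable def auxDepth {α : Type*} [DecidableEq α] (V : Finset α)
    (E : Finset (Finset α)) (k g d : ℕ) : Finset α :=
  (Finset.range (d + 1)).inf' (by simp) (fun i => kgLeaf V E (k - d + i) (g - i))

theorem kgValid_anti_left {α : Type*} [DecidableEq α] {V : Finset α}
    {E : Finset (Finset α)} {k l g : ℕ} {H : Finset α} (hkl : k ≤ l)
    (hH : kgValid V E l g H) : kgValid V E k g H :=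
  ⟨hH.1, fun v hv => hkl.trans (hH.2 v hv)⟩

theorem kgCore_anti_left {α : Type*} [DecidableEq α] (V : Finset α)
    (E : Finset (Finset α)) (g : ℕ) {k l : ℕ} (hkl : k ≤ l) :
    kgCore V E l g ⊆ kgCore V E k g := by
  classical
  exact Finset.sup_mono (Finset.monotone_filter_right _ fun _ _ hH => kgValid_anti_left hkl hH)

theorem kgLeaf_disjoint_of_lt {α : Type*} [DecidableEq α] (V : Finset α)
    (E : Finset (Finset α)) (g : ℕ) {k l : ℕ} (hkl : k < l) :
    Disjoint (kgLeaf V E l g) (kgLeaf V E k g) := by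
  refine Finset.disjoint_left.mpr fun v hl hk => ?_
  simp only [kgLeaf, Finset.mem_sdiff, Finset.mem_union, not_or] at hl hk
  exact hk.2.1 (kgCore_anti_left V E g hkl hl.1)

theorem auxDepth_subset_kgLeaf {α : Type*} [DecidableEq α] (V : Finset α)
    (E : Finset (Finset α)) (k g d : ℕ) :
    auxDepth V E k g d ⊆ kgLeaf V E (k - d) g :=
  Finset.inf'_le (fun i => kgLeaf V E (k - d + i) (g - i)) (Finset.mem_range.mpr d.succ_pos)

/-- Theorem 1: no node lies at two different depths of the same auxiliary node:
for `1 ≤ d' < d''` with `k - d'' ≥ 1` and `g - d'' ≥ 1`, the depth-`d'` and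
depth-`d''` entries of the `(k,g)`-auxiliary node are disjoint. -/
theorem auxDepth_disjoint {α : Type*} [DecidableEq α] (V : Finset α)
    (E : Finset (Finset α)) (k g d' d'' : ℕ) (hd' : 1 ≤ d') (hdd : d' < d'')
    (hk : 1 ≤ k - d'') (hg : 1 ≤ g - d'') :
    Disjoint (auxDepth V E k g d') (auxDepth V E k g d'') := by
  exact (kgLeaf_disjoint_of_lt V E g (by omega)).mono
    (auxDepth_subset_kgLeaf V E k g d') (auxDepth_subset_kgLeaf V E k g d'')
end
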